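/- Let p ∈ (1/2, 1). For every j ∈ ℕ, the kernel q_p satisfies the identity (Σ_{k=0}^{∞} q_p(j,k)·(k − 1)) − (j − 1) = (1/(1 − p))·(2 − 3p + p^{j+1}(2p − 1)), where the series on the left converges absolutely. -/

import Mathlib

open MeasureTheory Filter

noncomputable section

/-- The transition kernel of the Markov chain of leftward-jump counts associated with the
random walk in a homogeneous "have your cookie and eat it" environment with parameter `p`. -/
def qp (p : ℝ) (j k : ℕ) : ℝ :=
  if k = 0 then p ^ (j + 1)
  else (1 - p) * ∑ l ∈ Finset.range (j + 1),
    p ^ l * (Nat.choose (j - l + k - 1) (k - 1) : ℝ) * ((1 : ℝ) / 2) ^ (j - l + k)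

/-- `μ` is an invariant probability distribution on `ℕ` for the kernel `qp p`. -/
def IsInvariantFor (p : ℝ) (μ : ℕ → ℝ) : Prop :=
  (∀ k, 0 ≤ μ k) ∧ (∑' k, μ k) = 1 ∧ ∀ k, (∑' j, μ j * qp p j k) = μ k

/-- The mean of the number of failures before the `(m + 1)`-st success in fair coin tosses. -/
lemma hasSum_choose_half_mul (m : ℕ) :
    HasSum (fun n : ℕ => ((m + n).choose n : ℝ) * ((1 : ℝ) / 2) ^ (m + (n + 1)) * (n : ℝ))
      ((m : ℝ) + 1) := by
  rw [← hasSum_nat_add_iff' 1]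
  have h := (hasSum_choose_mul_geometric_of_norm_lt_one (m + 1)
    (r := (1 / 2 : ℝ)) (by norm_num)).mul_left (((m : ℝ) + 1) * (1 / 2) ^ (m + 2))
  convert! h using 1
  · funext n
    have h1 : (m + (n + 1)).choose (n + 1) * (n + 1) =
        (n + (m + 1)).choose (m + 1) * (m + 1) := by
      have h2 := Nat.add_one_mul_choose_eq (m + n) n
      have h3 := Nat.add_one_mul_choose_eq (m + n) m
      rw [Nat.choose_symm_add] at h3
      rw [show n + (m + 1) = m + n + 1 by ring, ← h3, ← add_assoc, ← h2]
    have h2 : ((m + (n + 1)).choose (n + 1) : ℝ) * (n + 1) =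
        (n + (m + 1)).choose (m + 1) * (m + 1) := by exact_mod_cast h1
    push_cast
    rw [mul_right_comm, h2]
    ring
  · simp
    field_simp
    rw [← mul_pow]
    norm_num

lemma one_sub_mul_sum_pow_mul {p : ℝ} (hp : p ≠ 1) (j : ℕ) :
    (1 - p) * ∑ l ∈ Finset.range (j + 1), p ^ l * (((j - l : ℕ) : ℝ) + 1) =
      (j + 1) - p * (1 - p ^ (j + 1)) / (1 - p) := by
  have hp' : 1 - p ≠ 0 := sub_ne_zero.mpr hp.symm
  induction j with
  | zero => simp; field_simp
  | succ j ih =>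
    rw [Finset.sum_range_succ']
    simp only [Nat.add_sub_add_right, pow_succ' p, mul_assoc, ← Finset.mul_sum] at ih ⊢
    rw [mul_add, mul_left_comm, ih]
    push_cast
    field_simp
    ring

lemma hasSum_qp_mul (p : ℝ) (j : ℕ) :
    HasSum (fun k : ℕ => qp p j k * ((k : ℝ) - 1))
      ((1 - p) * ∑ l ∈ Finset.range (j + 1), p ^ l * (((j - l : ℕ) : ℝ) + 1) - p ^ (j + 1)) := by
  rw [← hasSum_nat_add_iff' 1]
  convert! (hasSum_sum fun l (_ : l ∈ Finset.range (j + 1)) =>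
    (hasSum_choose_half_mul (j - l)).mul_left (p ^ l)).mul_left (1 - p) using 1
  · funext n
    simp only [qp, Nat.add_one_ne_zero, if_false, ← add_assoc, Nat.add_sub_cancel]
    push_cast
    rw [mul_assoc, Finset.sum_mul]
    congr 1
    refine Finset.sum_congr rfl fun l _ => ?_
    ring
  · simp [qp]

/-- First-moment identity for the kernel `qp p`. -/
theorem stmt15 (p : ℝ) (hp : p ∈ Set.Ioo (1 / 2 : ℝ) 1) :
    ∀ j : ℕ, Summable (fun k : ℕ => |qp p j k * ((k : ℝ) - 1)|) ∧
      (∑' k : ℕ, qp p j k * ((k : ℝ) - 1)) - ((j : ℝ) - 1) =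
        (1 / (1 - p)) * (2 - 3 * p + p ^ (j + 1) * (2 * p - 1)) := by
  intro j
  have h := hasSum_qp_mul p j
  refine ⟨h.summable.abs, ?_⟩
  have hp' : 1 - p ≠ 0 := sub_ne_zero.mpr hp.2.ne'
  rw [h.tsum_eq, one_sub_mul_sum_pow_mul hp.2.ne]
  field_simp
  ring
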